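/- arXiv:1404.1108 — 3 statements merged into one kernel-verified Lean document; each statement's English description precedes it below -/
import Mathlib

section
/- Let J be a positive integer, let items 1,…,J have sizes a_1,…,a_J and profits p_1,…,p_J with a_j > 0 and p_j ≥ 0 for all j, and let B > 0 and ε > 0. Assume the items are sorted by nonincreasing profit density, i.e. p_1/a_1 ≥ p_2/a_2 ≥ … ≥ p_J/a_J, that every item is small, i.e. a_j ≤ ε·B for all j, and that the total size exceeds the capacity, i.e. a_1 + … + a_J > B. Let κ be the least index with a_1 + … + a_κ > B. Then the greedy prefix value satisfies p_1 + … + p_{κ−1} ≥ (1 − ε)·(∑_{j∈S} p_j) for every subset S ⊆ {1,…,J} with ∑_{j∈S} a_j ≤ B; in particular the greedy knapsack algorithm, whose value is at least p_1 + … + p_{κ−1}, is at least (1 − ε)-suboptimal for the knapsack problem with capacity B. -/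
/-- If `q` is nonnegative on `P` and nonpositive on the rest of `S`, then `P` has a larger
`q`-sum than `S`. -/
theorem sum_le_sum_of_nonneg_of_nonpos_sdiff {ι : Type*} [DecidableEq ι] {S P : Finset ι}
    {q : ι → ℝ} (hP : ∀ j ∈ P, 0 ≤ q j) (hS : ∀ j ∈ S \ P, q j ≤ 0) :
    ∑ j ∈ S, q j ≤ ∑ j ∈ P, q j := by
  rw [← Finset.sum_inter_add_sum_sdiff S P]
  have h₁ : ∑ j ∈ S ∩ P, q j ≤ ∑ j ∈ P, q j :=
    Finset.sum_le_sum_of_subset_of_nonneg Finset.inter_subset_right fun j hj _ => hP j hj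
  have h₂ : ∑ j ∈ S \ P, q j ≤ 0 := Finset.sum_nonpos hS
  linarith

/-- Greedy knapsack prefix bound: if items `1,…,J` have positive sizes `a`,
nonnegative profits `p`, are sorted by nonincreasing profit density
(`p j / a j` nonincreasing, expressed multiplicatively), every item has size at
most `ε * B`, the total size exceeds the capacity `B`, and `κ` is the least
index whose prefix size-sum exceeds `B`, then the greedy prefix value
`p 1 + ⋯ + p (κ-1)` is at least `(1 - ε)` times the profit of any
capacity-feasible subset `S`. -/
theorem greedy_knapsack_prefix_suboptimality
    (J : ℕ) (hJ : 0 < J) (a p : ℕ → ℝ) (B ε : ℝ)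
    (ha : ∀ j ∈ Finset.Icc 1 J, 0 < a j)
    (hp : ∀ j ∈ Finset.Icc 1 J, 0 ≤ p j)
    (hB : 0 < B) (hε : 0 < ε)
    (hsorted : ∀ i j, 1 ≤ i → i ≤ j → j ≤ J → p j * a i ≤ p i * a j)
    (hsmall : ∀ j ∈ Finset.Icc 1 J, a j ≤ ε * B)
    (htotal : B < ∑ j ∈ Finset.Icc 1 J, a j)
    (κ : ℕ)
    (hκ : IsLeast {k | k ∈ Finset.Icc 1 J ∧ B < ∑ j ∈ Finset.Icc 1 k, a j} κ) :
    ∀ S ⊆ Finset.Icc 1 J, (∑ j ∈ S, a j) ≤ B →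
      (1 - ε) * (∑ j ∈ S, p j) ≤ ∑ j ∈ Finset.Icc 1 (κ - 1), p j := by
  intro S hS hSB
  obtain ⟨⟨hκJ, hκB⟩, -⟩ := hκ
  have haκ := ha κ hκJ
  have hsκ := hsmall κ hκJ
  have hpκ := hp κ hκJ
  obtain ⟨h1κ, hκJ⟩ := Finset.mem_Icc.1 hκJ
  obtain ⟨r, hr⟩ : ∃ r, p κ = r * a κ := ⟨p κ / a κ, (div_mul_cancel₀ _ haκ.ne').symm⟩
  have hr0 : 0 ≤ r := nonneg_of_mul_nonneg_left (hr ▸ hpκ) haκ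
  have hprefix : (1 - ε) * B ≤ ∑ j ∈ Finset.Icc 1 (κ - 1), a j := by
    obtain ⟨m, rfl⟩ := Nat.exists_eq_add_of_le' h1κ
    rw [Finset.sum_Icc_succ_top h1κ] at hκB
    rw [Nat.add_sub_cancel]
    linarith
  have hhigh : ∀ j ∈ Finset.Icc 1 (κ - 1), 0 ≤ p j - r * a j := by
    intro j hj
    rw [Finset.mem_Icc] at hj
    have h := hsorted j κ hj.1 (by lia) hκJ
    rw [hr] at h
    nlinarith
  have hlow : ∀ j ∈ S \ Finset.Icc 1 (κ - 1), p j - r * a j ≤ 0 := by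
    intro j hj
    rw [Finset.mem_sdiff, Finset.mem_Icc] at hj
    have hjJ := Finset.mem_Icc.1 (hS hj.1)
    have h := hsorted κ j h1κ (by lia) hjJ.2
    rw [hr] at h
    nlinarith
  have hexch := sum_le_sum_of_nonneg_of_nonpos_sdiff hhigh hlow
  have hdens := Finset.sum_nonneg hhigh
  simp only [Finset.sum_sub_distrib, ← Finset.mul_sum] at hexch hdens
  have hV : 0 ≤ ∑ j ∈ S, p j := Finset.sum_nonneg fun j hj => hp j (hS hj)
  have hG : 0 ≤ ∑ j ∈ Finset.Icc 1 (κ - 1), p j :=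
    Finset.sum_nonneg fun j hj => hp j (Finset.Icc_subset_Icc_right (by lia) hj)
  generalize ∑ j ∈ S, p j = V at *
  generalize ∑ j ∈ Finset.Icc 1 (κ - 1), p j = G at *
  generalize ∑ j ∈ S, a j = C at *
  generalize ∑ j ∈ Finset.Icc 1 (κ - 1), a j = A at *
  rcases le_total 1 ε with h | h
  · nlinarith
  · have hVG : V ≤ G + r * (B - A) := by nlinarith [mul_le_mul_of_nonneg_left hSB hr0]
    calc (1 - ε) * V ≤ (1 - ε) * (G + r * (B - A)) :=
          mul_le_mul_of_nonneg_left hVG (sub_nonneg.2 h)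
      _ = G - ε * (G - r * A) - r * (A - (1 - ε) * B) := by ring
      _ ≤ G := by
          have h₁ := mul_nonneg hε.le hdens
          have h₂ := mul_nonneg hr0 (sub_nonneg.2 hprefix)
          linarith
end

section
/- Let m and B be positive integers and let r_1,…,r_{3m} be positive integers with r_1 + … + r_{3m} = m·B and B/4 < r_j < B/2 for every j. Then the following are equivalent: (1) there exists an assignment y, specifying for each node i ∈ {1,…,m} a set of videos cached at i, such that for every node i the total size ∑_{k cached at i} r_k is at most B, and every video k ∈ {1,…,3m} is cached at at least one node; (2) the multiset {r_1,…,r_{3m}} can be partitioned into m subsets each of which sums to exactly B. -/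
/-- 3-Partition reduction for MHP feasibility: given `3m` positive integers
`r j` summing to `m * B` with `B/4 < r j < B/2` for every `j`, there is a
feasible caching placement on `m` nodes of capacity `B` (every video cached at
at least one node, each node's cached videos fitting in `B`) if and only if
the multiset `{r j}` can be partitioned into `m` subsets each summing to
exactly `B`. -/
theorem mhp_feasibility_iff_three_partition
    (m B : ℕ) (hm : 0 < m) (hB : 0 < B)
    (r : Fin (3 * m) → ℕ) (hr : ∀ j, 0 < r j)
    (hsum : (∑ j, r j) = m * B)
    (hbound : ∀ j, B < 4 * r j ∧ 2 * r j < B) :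
    (∃ y : Fin m → Finset (Fin (3 * m)),
        (∀ i, (∑ k ∈ y i, r k) ≤ B) ∧ (∀ k, ∃ i, k ∈ y i)) ↔
    (∃ f : Fin (3 * m) → Fin m,
        ∀ i, (∑ k ∈ Finset.univ.filter (fun k => f k = i), r k) = B) := by
  constructor
  · rintro ⟨y, hcap, hcover⟩
    choose f hf using hcover
    have hle : ∀ i ∈ Finset.univ,
        (∑ k ∈ Finset.univ.filter (fun k => f k = i), r k) ≤ B := fun i _ =>
      (Finset.sum_le_sum_of_subset fun k hk => (Finset.mem_filter.mp hk).2 ▸ hf k).trans (hcap i)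
    have htotal : (∑ i, ∑ k ∈ Finset.univ.filter (fun k => f k = i), r k) =
        ∑ _i : Fin m, B := by
      rw [Finset.sum_fiberwise, hsum]
      simp
    exact ⟨f, fun i => (Finset.sum_eq_sum_iff_of_le hle).mp htotal i (Finset.mem_univ i)⟩
  · rintro ⟨f, hf⟩
    exact ⟨fun i => Finset.univ.filter (fun k => f k = i), fun i => (hf i).le,
      fun k => ⟨f k, by simp⟩⟩
end

section
/- Let n and L be positive integers, let K ⊆ ℝⁿ be a convex set, and for each l = 1,…,L let f_l : ℝⁿ → ℝ be a linear map that is nonnegative on K, let c_l ≥ 0, and let ζ_l : ℝ → ℝ be convex and monotone nondecreasing. Then the function g(x) = ∑_{l=1}^{L} f_l(x)·ζ_l(f_l(x) + c_l) is convex on K. -/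
/-- If `φ` is convex and monotone, then `u ↦ u * φ (u + c)` is convex on the nonnegative reals. -/
theorem ConvexOn.mul_comp_add_of_monotone {φ : ℝ → ℝ} (hφ : ConvexOn ℝ Set.univ φ)
    (hmono : Monotone φ) (c : ℝ) :
    ConvexOn ℝ (Set.Ici 0) (fun u => u * φ (u + c)) := by
  refine ⟨convex_Ici 0, fun u hu v hv a b ha hb hab => ?_⟩
  simp only [Set.mem_Ici, smul_eq_mul] at *
  have hconv : φ (a * u + b * v + c) ≤ a * φ (u + c) + b * φ (v + c) := by
    have h := hφ.2 (Set.mem_univ (u + c)) (Set.mem_univ (v + c)) ha hb hab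
    simp only [smul_eq_mul] at h
    have harg : a * (u + c) + b * (v + c) = a * u + b * v + c := by
      linear_combination c * hab
    rwa [harg] at h
  have hcross : 0 ≤ (u - v) * (φ (u + c) - φ (v + c)) := by
    rcases le_total u v with h | h
    · exact mul_nonneg_of_nonpos_of_nonpos (sub_nonpos.2 h)
        (sub_nonpos.2 (hmono (by linarith)))
    · exact mul_nonneg (sub_nonneg.2 h) (sub_nonneg.2 (hmono (by linarith)))
  calc (a * u + b * v) * φ (a * u + b * v + c)
      ≤ (a * u + b * v) * (a * φ (u + c) + b * φ (v + c)) :=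
        mul_le_mul_of_nonneg_left hconv (by positivity)
    _ ≤ (a * u + b * v) * (a * φ (u + c) + b * φ (v + c))
          + a * b * ((u - v) * (φ (u + c) - φ (v + c))) :=
        le_add_of_nonneg_right (by positivity)
    _ = a * (u * φ (u + c)) + b * (v * φ (v + c)) := by
        obtain rfl : b = 1 - a := by linarith
        ring

/-- Convexity of the MRCP objective: on a convex set `K ⊆ ℝⁿ`, if each
`f l : ℝⁿ → ℝ` is linear and nonnegative on `K`, `c l ≥ 0`, and each
`ζ l : ℝ → ℝ` is convex and monotone nondecreasing, then
`x ↦ ∑ l, f l x * ζ l (f l x + c l)` is convex on `K`. -/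
theorem mrcp_objective_convexOn
    (n L : ℕ) (hn : 0 < n) (hL : 0 < L)
    (K : Set (Fin n → ℝ)) (hK : Convex ℝ K)
    (f : Fin L → ((Fin n → ℝ) →ₗ[ℝ] ℝ))
    (hf : ∀ l, ∀ x ∈ K, 0 ≤ f l x)
    (c : Fin L → ℝ) (hc : ∀ l, 0 ≤ c l)
    (ζ : Fin L → (ℝ → ℝ))
    (hζconv : ∀ l, ConvexOn ℝ Set.univ (ζ l))
    (hζmono : ∀ l, Monotone (ζ l)) :
    ConvexOn ℝ K (fun x => ∑ l, f l x * ζ l (f l x + c l)) := by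
  refine ⟨hK, fun x hx y hy a b ha hb hab => ?_⟩
  simp only [Finset.smul_sum, ← Finset.sum_add_distrib]
  refine Finset.sum_le_sum fun l _ => ?_
  simpa only [map_add, map_smul] using
    ((hζconv l).mul_comp_add_of_monotone (hζmono l) (c l)).2 (hf l x hx) (hf l y hy) ha hb hab
end
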